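/- arXiv:2304.06464 — 6 statements merged into one kernel-verified Lean document; each statement's English description precedes it below -/
import Mathlib

section
/- The pair of functions t ↦ cos(√g(k)·t) and t ↦ −i·(√g(k)/I(k))·sin(√g(k)·t) solves the Fourier-transformed Schrödinger system of the 2-periodic continuous-time quantum walk: for every k ∈ [−π, π) and every t ≥ 0, writing ψ̂₀,ₜ(k) = cos(√g(k)·t) and ψ̂₁,ₜ(k) = −i·(√g(k)/I(k))·sin(√g(k)·t), one has i·(d/dt)ψ̂₀,ₜ(k) = (γ₁e^{−ik} + γ₀e^{ik})·ψ̂₁,ₜ(k) and i·(d/dt)ψ̂₁,ₜ(k) = (γ₀e^{−ik} + γ₁e^{ik})·ψ̂₀,ₜ(k), with initial conditions ψ̂₀,₀(k) = 1 and ψ̂₁,₀(k) = 0. -/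
open Real

/-- The squared modulus of `a e^{ik} + b e^{-ik}`, as a trigonometric polynomial, is positive when
`|a| ≠ |b|`. -/
theorem sq_add_sq_add_two_mul_cos_pos {a b : ℝ} (h : |a| ≠ |b|) (k : ℝ) :
    0 < a ^ 2 + b ^ 2 + 2 * a * b * Real.cos (2 * k) := by
  have hadd : 0 < (a + b) ^ 2 := by
    refine sq_pos_of_ne_zero fun h0 => h ?_
    rw [eq_neg_of_add_eq_zero_left h0, abs_neg]
  have hsub : 0 < (a - b) ^ 2 := by
    refine sq_pos_of_ne_zero fun h0 => h ?_
    rw [sub_eq_zero.mp h0]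
  have hrw : a ^ 2 + b ^ 2 + 2 * a * b * Real.cos (2 * k) =
      (a + b) ^ 2 * Real.cos k ^ 2 + (a - b) ^ 2 * Real.sin k ^ 2 := by
    rw [Real.cos_two_mul, Real.sin_sq]
    ring
  rw [hrw]
  rcases eq_or_ne (Real.cos k) 0 with hc | hc
  · have hs : Real.sin k ^ 2 = 1 := by rw [Real.sin_sq, hc]; ring
    rw [hc, hs]
    linarith
  · positivity

/-- The product of `a e^{ik} + b e^{-ik}` with its conjugate. -/
theorem exp_add_exp_mul_conj (a b k : ℝ) :
    ((a : ℂ) * Complex.exp (Complex.I * k) + b * Complex.exp (-(Complex.I * k))) *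
      (a * Complex.exp (-(Complex.I * k)) + b * Complex.exp (Complex.I * k)) =
    ((a ^ 2 + b ^ 2 + 2 * a * b * Real.cos (2 * k) : ℝ) : ℂ) := by
  have hcos : Complex.cos k =
      (Complex.exp (Complex.I * k) + Complex.exp (-(Complex.I * k))) / 2 := by
    rw [Complex.cos, neg_mul, mul_comm]
  have hexp : Complex.exp (Complex.I * k) * Complex.exp (-(Complex.I * k)) = 1 := by
    rw [← Complex.exp_add, add_neg_cancel, Complex.exp_zero]
  push_cast
  rw [Complex.cos_two_mul, hcos]
  linear_combination ((a : ℂ) ^ 2 + b ^ 2 - 2 * a * b) * hexp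

theorem hasDerivAt_ofReal_cos_mul (w t : ℝ) :
    HasDerivAt (fun s : ℝ => (Real.cos (w * s) : ℂ)) (-(w * Real.sin (w * t) : ℂ)) t := by
  have h := (((hasDerivAt_id t).const_mul w).cos).ofReal_comp
  refine h.congr_deriv ?_
  push_cast [id]
  ring

theorem hasDerivAt_ofReal_sin_mul (w t : ℝ) :
    HasDerivAt (fun s : ℝ => (Real.sin (w * s) : ℂ)) (w * Real.cos (w * t) : ℂ) t := by
  have h := (((hasDerivAt_id t).const_mul w).sin).ofReal_comp
  refine h.congr_deriv ?_
  push_cast [id]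
  ring

/-- The pair `ψ̂₀ₜ(k) = cos(√g(k)·t)`, `ψ̂₁ₜ(k) = -i (√g(k)/I(k)) sin(√g(k)·t)` solves the
Fourier-transformed Schrödinger system of the 2-periodic continuous-time quantum walk,
with initial conditions `ψ̂₀,₀(k) = 1`, `ψ̂₁,₀(k) = 0`. -/
theorem stmt_0 (γ₀ γ₁ : ℝ) (hγ₀ : γ₀ ≠ 0) (hγ₁ : γ₁ ≠ 0) (hne : |γ₀| ≠ |γ₁|)
    (g : ℝ → ℝ) (hg : ∀ k, g k = γ₀ ^ 2 + γ₁ ^ 2 + 2 * γ₀ * γ₁ * Real.cos (2 * k))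
    (I : ℝ → ℂ)
    (hI : ∀ k, I k = (γ₀ : ℂ) * Complex.exp (Complex.I * (k : ℂ)) +
        (γ₁ : ℂ) * Complex.exp (-(Complex.I * (k : ℂ))))
    (ψ₀ ψ₁ : ℝ → ℝ → ℂ)
    (hψ₀ : ∀ k t, ψ₀ k t = (Real.cos (Real.sqrt (g k) * t) : ℂ))
    (hψ₁ : ∀ k t, ψ₁ k t =
      -Complex.I * ((Real.sqrt (g k) : ℂ) / I k) * (Real.sin (Real.sqrt (g k) * t) : ℂ)) :
    ∀ k ∈ Set.Ico (-π) π,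
      (∀ t : ℝ, 0 ≤ t →
        Complex.I * deriv (fun s : ℝ => ψ₀ k s) t =
          ((γ₁ : ℂ) * Complex.exp (-(Complex.I * (k : ℂ))) +
            (γ₀ : ℂ) * Complex.exp (Complex.I * (k : ℂ))) * ψ₁ k t ∧
        Complex.I * deriv (fun s : ℝ => ψ₁ k s) t =
          ((γ₀ : ℂ) * Complex.exp (-(Complex.I * (k : ℂ))) +
            (γ₁ : ℂ) * Complex.exp (Complex.I * (k : ℂ))) * ψ₀ k t) ∧
      ψ₀ k 0 = 1 ∧ ψ₁ k 0 = 0 := by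
  intro k _
  have hpos : 0 < g k := hg k ▸ sq_add_sq_add_two_mul_cos_pos hne k
  have hmul := exp_add_exp_mul_conj γ₀ γ₁ k
  rw [← hI, ← hg] at hmul
  have hI0 : I k ≠ 0 := by
    intro h0
    rw [h0, zero_mul] at hmul
    exact hpos.ne (by exact_mod_cast hmul)
  have hsqrt : (Real.sqrt (g k) : ℂ) * Real.sqrt (g k) = g k := by
    exact_mod_cast Real.mul_self_sqrt hpos.le
  refine ⟨fun t _ => ⟨?_, ?_⟩, ?_, ?_⟩
  · simp only [hψ₀, hψ₁]
    rw [(hasDerivAt_ofReal_cos_mul _ t).deriv, add_comm, ← hI]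
    field_simp
  · simp only [hψ₀, hψ₁]
    rw [((hasDerivAt_ofReal_sin_mul _ t).const_mul _).deriv]
    field_simp
    rw [Complex.I_sq]
    linear_combination (Real.cos (Real.sqrt (g k) * t) : ℂ) * (hsqrt - hmul)
  · simp [hψ₀]
  · simp [hψ₁]
end

section
/- The family of amplitudes defined by the integral formulas ψ_t(2n) = ∫₀^{π/2} (2/π)·cos(2nk)·cos(√g(k)·t) dk and ψ_t(2n+1) = −i·∫₀^{π/2} (2/π)·{γ₀cos(2nk) + γ₁cos(2(n+1)k)}·sin(√g(k)·t)/√g(k) dk (n ∈ ℤ) satisfies, for every t ≥ 0 and n ∈ ℤ, the discrete-space Schrödinger equations i·(d/dt)ψ_t(2n) = γ₁ψ_t(2n−1) + γ₀ψ_t(2n+1) and i·(d/dt)ψ_t(2n+1) = γ₀ψ_t(2n) + γ₁ψ_t(2n+2), together with the localized initial condition ψ₀(0) = 1 and ψ₀(x) = 0 for every integer x ≠ 0. -/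
open Real MeasureTheory intervalIntegral

/-- Differentiation under the integral sign when the derivative is bounded by a continuous
function that does not depend on the parameter. -/
lemma hasDerivAt_integral_of_continuous_bound {a b : ℝ} {F F' : ℝ → ℝ → ℝ} {B : ℝ → ℝ}
    (hF : ∀ t, Continuous (F t)) (hF' : ∀ t, Continuous (F' t)) (hB : Continuous B)
    (hbound : ∀ t k, |F' t k| ≤ B k) (hderiv : ∀ t k, HasDerivAt (fun s => F s k) (F' t k) t)
    (t : ℝ) :
    HasDerivAt (fun s => ∫ k in a..b, F s k) (∫ k in a..b, F' t k) t :=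
  (intervalIntegral.hasDerivAt_integral_of_dominated_loc_of_deriv_le (bound := B)
    Filter.univ_mem (Filter.Eventually.of_forall fun s => (hF s).aestronglyMeasurable)
    ((hF t).intervalIntegrable _ _) (hF' t).aestronglyMeasurable
    (Filter.Eventually.of_forall fun k _ s _ => hbound s k) (hB.intervalIntegrable _ _)
    (Filter.Eventually.of_forall fun k _ s _ => hderiv s k)).2

lemma add_sq_add_two_mul_cos_pos {a b : ℝ} (hab : |a| ≠ |b|) (x : ℝ) :
    0 < a ^ 2 + b ^ 2 + 2 * a * b * Real.cos x := by
  have h1 : 0 < (|a| - |b|) ^ 2 := by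
    have := sub_ne_zero.mpr hab
    positivity
  have h2 : |a * b * Real.cos x| ≤ |a| * |b| := by
    rw [abs_mul, abs_mul]
    exact mul_le_of_le_one_right (by positivity) (Real.abs_cos_le_one x)
  have h3 := neg_le_of_abs_le h2
  nlinarith [sq_abs a, sq_abs b]

lemma integral_cos_two_mul_int (n : ℤ) :
    ∫ k in (0 : ℝ)..(π / 2), (2 / π) * Real.cos (2 * (n : ℝ) * k) = if n = 0 then 1 else 0 := by
  split_ifs with hn
  · subst hn
    simp [Real.pi_ne_zero]
  · have hc : (2 * (n : ℝ)) ≠ 0 := by simpa using hn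
    rw [intervalIntegral.integral_const_mul, intervalIntegral.integral_comp_mul_left _ hc,
      integral_cos]
    have : 2 * (n : ℝ) * (π / 2) = n * π := by ring
    simp [this, Real.sin_int_mul_pi]

open Real MeasureTheory intervalIntegral

/-- The amplitudes defined by the integral formulas satisfy the discrete-space
Schrödinger equations of the 2-periodic continuous-time quantum walk, together with
the localized initial condition. -/
theorem stmt_2 (γ₀ γ₁ : ℝ) (hγ₀ : γ₀ ≠ 0) (hγ₁ : γ₁ ≠ 0) (hne : |γ₀| ≠ |γ₁|)
    (g : ℝ → ℝ) (hg : ∀ k, g k = γ₀ ^ 2 + γ₁ ^ 2 + 2 * γ₀ * γ₁ * Real.cos (2 * k))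
    (ψ : ℝ → ℤ → ℂ)
    (hψe : ∀ (t : ℝ) (n : ℤ), ψ t (2 * n) =
      ((∫ k in (0:ℝ)..(π / 2),
        (2 / π) * Real.cos (2 * (n : ℝ) * k) * Real.cos (Real.sqrt (g k) * t)) : ℂ))
    (hψo : ∀ (t : ℝ) (n : ℤ), ψ t (2 * n + 1) =
      -Complex.I * ((∫ k in (0:ℝ)..(π / 2),
        (2 / π) * (γ₀ * Real.cos (2 * (n : ℝ) * k) + γ₁ * Real.cos (2 * ((n : ℝ) + 1) * k)) *
          Real.sin (Real.sqrt (g k) * t) / Real.sqrt (g k)) : ℂ)) :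
    (∀ t : ℝ, 0 ≤ t → ∀ n : ℤ,
      Complex.I * deriv (fun s : ℝ => ψ s (2 * n)) t =
        (γ₁ : ℂ) * ψ t (2 * n - 1) + (γ₀ : ℂ) * ψ t (2 * n + 1) ∧
      Complex.I * deriv (fun s : ℝ => ψ s (2 * n + 1)) t =
        (γ₀ : ℂ) * ψ t (2 * n) + (γ₁ : ℂ) * ψ t (2 * n + 2)) ∧
    ψ 0 0 = 1 ∧ (∀ x : ℤ, x ≠ 0 → ψ 0 x = 0) := by
  have hgpos : ∀ k, 0 < g k := fun k => by
    rw [hg]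
    exact add_sq_add_two_mul_cos_pos hne _
  have hgc : Continuous g := by
    rw [funext hg]
    fun_prop
  set w : ℝ → ℝ := fun k => Real.sqrt (g k) with hw
  have hwc : Continuous w := Real.continuous_sqrt.comp hgc
  have hw0 : ∀ k, w k ≠ 0 := fun k => (Real.sqrt_pos.mpr (hgpos k)).ne'
  have hwsq : ∀ k, w k * w k = g k := fun k => Real.mul_self_sqrt (hgpos k).le
  let e : ℤ → ℝ → ℝ → ℝ := fun n t k =>
    (2 / π) * Real.cos (2 * (n : ℝ) * k) * Real.cos (w k * t)
  let c : ℤ → ℝ → ℝ := fun n k =>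
    (2 / π) * (γ₀ * Real.cos (2 * (n : ℝ) * k) + γ₁ * Real.cos (2 * ((n : ℝ) + 1) * k))
  let o : ℤ → ℝ → ℝ → ℝ := fun n t k => c n k * Real.sin (w k * t) / w k
  have hcc : ∀ n, Continuous (c n) := fun n => by fun_prop
  have hec : ∀ n t, Continuous (e n t) := fun n t => by fun_prop
  have hoc : ∀ n t, Continuous (o n t) := fun n t =>
    ((hcc n).mul (by fun_prop)).div hwc hw0
  have hE : ∀ t n, ψ t (2 * n) = ((∫ k in (0 : ℝ)..(π / 2), e n t k : ℝ) : ℂ) := fun t n => by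
    rw [hψe, ← intervalIntegral.integral_ofReal]
    simp [e, hw]
  have hO : ∀ t n, ψ t (2 * n + 1) =
      -Complex.I * ((∫ k in (0 : ℝ)..(π / 2), o n t k : ℝ) : ℂ) := fun t n => by
    rw [hψo, ← intervalIntegral.integral_ofReal]
    simp [o, c, hw]
  have hdE : ∀ n t, HasDerivAt (fun s => ∫ k in (0 : ℝ)..(π / 2), e n s k)
      (∫ k in (0 : ℝ)..(π / 2),
        -((2 / π) * Real.cos (2 * (n : ℝ) * k) * (w k * Real.sin (w k * t)))) t := fun n t => by
    refine hasDerivAt_integral_of_continuous_bound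
      (F' := fun t k => -((2 / π) * Real.cos (2 * (n : ℝ) * k) * (w k * Real.sin (w k * t))))
      (B := fun k => |(2 / π) * Real.cos (2 * (n : ℝ) * k)| * |w k|) (hec n)
      (fun t => by fun_prop) (by fun_prop) (fun t k => ?_) (fun t k => ?_) t
    · rw [abs_neg, abs_mul, abs_mul (w k)]
      gcongr
      exact mul_le_of_le_one_right (abs_nonneg _) (Real.abs_sin_le_one _)
    · have h := (((hasDerivAt_id t).const_mul (w k)).cos).const_mul
        ((2 / π) * Real.cos (2 * (n : ℝ) * k))
      refine h.congr_deriv ?_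
      simp only [id]
      ring
  have hdO : ∀ n t, HasDerivAt (fun s => ∫ k in (0 : ℝ)..(π / 2), o n s k)
      (∫ k in (0 : ℝ)..(π / 2), c n k * Real.cos (w k * t)) t := fun n t => by
    refine hasDerivAt_integral_of_continuous_bound
      (F' := fun t k => c n k * Real.cos (w k * t)) (B := fun k => |c n k|) (hoc n)
      (fun t => by fun_prop) (hcc n).abs (fun t k => ?_) (fun t k => ?_) t
    · rw [abs_mul]
      exact mul_le_of_le_one_right (abs_nonneg _) (Real.abs_cos_le_one _)
    · have h := ((((hasDerivAt_id t).const_mul (w k)).sin).const_mul (c n k)).div_const (w k)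
      refine h.congr_deriv ?_
      have := hw0 k
      simp only [id]
      field_simp
  have hint : ∀ n, ∫ k in (0 : ℝ)..(π / 2), e n 0 k = if n = 0 then 1 else 0 := fun n => by
    simpa [e] using integral_cos_two_mul_int n
  refine ⟨fun t _ n => ⟨?_, ?_⟩, ?_, fun x hx => ?_⟩
  · have hd := (hdE n t).ofReal_comp
    simp only [← hE] at hd
    have key : (∫ k in (0 : ℝ)..(π / 2),
        -((2 / π) * Real.cos (2 * (n : ℝ) * k) * (w k * Real.sin (w k * t)))) =
        -(γ₁ * (∫ k in (0 : ℝ)..(π / 2), o (n - 1) t k) +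
          γ₀ * ∫ k in (0 : ℝ)..(π / 2), o n t k) := by
      rw [← intervalIntegral.integral_const_mul, ← intervalIntegral.integral_const_mul,
        ← intervalIntegral.integral_add
          (((hoc _ t).const_mul _).intervalIntegrable _ _)
          (((hoc _ t).const_mul _).intervalIntegrable _ _),
        ← intervalIntegral.integral_neg]
      refine intervalIntegral.integral_congr fun k _ => ?_
      have h0 := hw0 k
      have h1 : Real.cos (2 * ((n : ℝ) + 1) * k) =
          2 * Real.cos (2 * k) * Real.cos (2 * n * k) - Real.cos (2 * ((n : ℝ) - 1) * k) := by
        rw [show 2 * ((n : ℝ) + 1) * k = 2 * n * k + 2 * k by ring,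
          show 2 * ((n : ℝ) - 1) * k = 2 * n * k - 2 * k by ring, Real.cos_add, Real.cos_sub]
        ring
      have h2 := (hwsq k).trans (hg k)
      simp only [o, c]
      push_cast
      rw [sub_add_cancel, h1]
      field_simp
      linear_combination (-(Real.cos (2 * n * k) * Real.sin (w k * t))) * h2
    rw [hd.deriv, show 2 * n - 1 = 2 * (n - 1) + 1 by ring, hO, hO, key]
    push_cast
    ring
  · have hd := ((hdO n t).ofReal_comp).const_mul (-Complex.I)
    simp only [← hO] at hd
    have key : (∫ k in (0 : ℝ)..(π / 2), c n k * Real.cos (w k * t)) =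
        γ₀ * (∫ k in (0 : ℝ)..(π / 2), e n t k) +
          γ₁ * ∫ k in (0 : ℝ)..(π / 2), e (n + 1) t k := by
      rw [← intervalIntegral.integral_const_mul, ← intervalIntegral.integral_const_mul,
        ← intervalIntegral.integral_add
          (((hec _ t).const_mul _).intervalIntegrable _ _)
          (((hec _ t).const_mul _).intervalIntegrable _ _)]
      refine intervalIntegral.integral_congr fun k _ => ?_
      simp only [e, c]
      push_cast
      ring
    rw [hd.deriv, show 2 * n + 2 = 2 * (n + 1) by ring, hE, hE, key]
    push_cast
    linear_combination (-(γ₀ * ((∫ k in (0 : ℝ)..(π / 2), e n t k : ℝ) : ℂ) +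
      γ₁ * ((∫ k in (0 : ℝ)..(π / 2), e (n + 1) t k : ℝ) : ℂ))) * Complex.I_mul_I
  · have := hE 0 0
    rw [hint] at this
    simpa using this
  · obtain ⟨n, rfl | rfl⟩ := Int.even_or_odd' x
    · rw [hE, hint, if_neg (by rintro rfl; simp at hx)]
      simp
    · rw [hO]
      simp [o]
end

section
/- Let ξ ∈ {0,1} satisfy |γ_ξ| = min{|γ₀|, |γ₁|}. Suppose γ₀γ₁ > 0 and 0 < x < 2|γ_ξ| (resp. γ₀γ₁ < 0 and −2|γ_ξ| < x < 0). Define k₊(x) = (1/2)·arccos((−x² + √(4γ₀² − x²)·√(4γ₁² − x²))/(4γ₀γ₁)) and k₋(x) = (1/2)·arccos((−x² − √(4γ₀² − x²)·√(4γ₁² − x²))/(4γ₀γ₁)) (resp. with the roles of the ± signs inside the arccos interchanged). Then k₊(x) and k₋(x) both lie in [0, π/2], they satisfy h(k₊(x)) = x and h(k₋(x)) = x, and k₊(x) ≤ k₋(x); moreover they are the only solutions of h(k) = x with k ∈ [0, π/2]. -/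
open Real

/-- On `[0, π/2]` the equation `h(k) = x` is a quadratic equation in `cos (2 * k)`. -/
lemma dispersion_eq_iff_quadratic {a b x k : ℝ} (hne : |a| ≠ |b|) (hx : 0 < a * b * x)
    (hk : k ∈ Set.Icc 0 (π / 2)) :
    2 * a * b * Real.sin (2 * k) / √(a ^ 2 + b ^ 2 + 2 * a * b * Real.cos (2 * k)) = x ↔
      (4 * a * b * Real.cos (2 * k) + x ^ 2) ^ 2 = (4 * a ^ 2 - x ^ 2) * (4 * b ^ 2 - x ^ 2) := by
  have hsin : 0 ≤ Real.sin (2 * k) :=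
    Real.sin_nonneg_of_nonneg_of_le_pi (by linarith [hk.1]) (by linarith [hk.2])
  have hsc := Real.sin_sq_add_cos_sq (2 * k)
  have hg : 0 < a ^ 2 + b ^ 2 + 2 * a * b * Real.cos (2 * k) := by
    have h_sub : 0 < (a - b) ^ 2 := by
      have : a - b ≠ 0 := fun h => hne (by rw [sub_eq_zero.mp h])
      positivity
    have h_add : 0 < (a + b) ^ 2 := by
      have : a + b ≠ 0 := fun h => hne (by rw [eq_neg_of_add_eq_zero_left h, abs_neg])
      positivity
    rcases le_total 0 (a * b) with hab | hab
    · nlinarith [mul_nonneg hab (by linarith [Real.neg_one_le_cos (2 * k)] :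
        0 ≤ 1 + Real.cos (2 * k))]
    · nlinarith [mul_nonneg (neg_nonneg.mpr hab) (by linarith [Real.cos_le_one (2 * k)] :
        0 ≤ 1 - Real.cos (2 * k))]
  have hsq := Real.sq_sqrt hg.le
  have hr := Real.sqrt_pos.mpr hg
  set r := √(a ^ 2 + b ^ 2 + 2 * a * b * Real.cos (2 * k))
  set s := Real.sin (2 * k)
  set c := Real.cos (2 * k)
  rw [div_eq_iff hr.ne']
  have hquad : (4 * a * b * c + x ^ 2) ^ 2 = (4 * a ^ 2 - x ^ 2) * (4 * b ^ 2 - x ^ 2) ↔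
      (2 * a * b * s) ^ 2 = (x * r) ^ 2 := by
    have h_diff : (4 * a * b * c + x ^ 2) ^ 2 - (4 * a ^ 2 - x ^ 2) * (4 * b ^ 2 - x ^ 2) =
        -4 * ((2 * a * b * s) ^ 2 - (x * r) ^ 2) := by
      linear_combination (16 * a ^ 2 * b ^ 2) * hsc - 4 * x ^ 2 * hsq
    constructor <;> intro h <;> linarith
  rw [hquad, sq_eq_sq_iff_eq_or_eq_neg]
  refine ⟨Or.inl, fun h => h.elim id fun h => ?_⟩
  have hx0 : x ≠ 0 := by
    rintro rfl
    simp at hx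
  have h_pos : 0 < x ^ 2 * r := by positivity
  nlinarith [mul_nonneg hx.le hsin]

/-- The roots of the quadratic equation for `cos (2 * k)` lie in `[-1, 1]`. -/
lemma quadratic_root_mem_Icc {a b x T : ℝ} (ha : x ^ 2 < 4 * a ^ 2) (hb : x ^ 2 < 4 * b ^ 2)
    (hT : T ^ 2 = (4 * a ^ 2 - x ^ 2) * (4 * b ^ 2 - x ^ 2)) :
    (-x ^ 2 + T) / (4 * a * b) ∈ Set.Icc (-1) 1 := by
  have ha0 : 0 < |a| := by
    rw [abs_pos]
    rintro rfl
    nlinarith [sq_nonneg x]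
  have hb0 : 0 < |b| := by
    rw [abs_pos]
    rintro rfl
    nlinarith [sq_nonneg x]
  have hxa : |x| < 2 * |a| :=
    abs_lt_of_sq_lt_sq (by rw [mul_pow, sq_abs]; linarith) (by positivity)
  have hxb : |x| < 2 * |b| :=
    abs_lt_of_sq_lt_sq (by rw [mul_pow, sq_abs]; linarith) (by positivity)
  have hx : x ^ 2 ≤ 4 * (|a| * |b|) := by
    rw [← sq_abs x]
    nlinarith [abs_nonneg x]
  have hT_abs : |T| ≤ 4 * (|a| * |b|) - x ^ 2 := by
    refine abs_le_of_sq_le_sq ?_ (by linarith)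
    rw [hT]
    nlinarith [mul_nonneg (sq_nonneg x) (sq_nonneg (|a| - |b|)), sq_abs a, sq_abs b,
      congrArg₂ (· * ·) (sq_abs a) (sq_abs b)]
  rw [Set.mem_Icc, ← abs_le, abs_div, abs_mul, abs_mul, div_le_one (by positivity)]
  refine (abs_add_le _ _).trans ?_
  rw [abs_neg, abs_of_nonneg (sq_nonneg x), abs_of_pos (by norm_num : (0 : ℝ) < 4)]
  linarith

lemma half_arccos_mem_Icc (v : ℝ) : 1 / 2 * Real.arccos v ∈ Set.Icc 0 (π / 2) :=
  ⟨by linarith [Real.arccos_nonneg v], by linarith [Real.arccos_le_pi v]⟩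

lemma dispersion_half_arccos {a b x T : ℝ} (hne : |a| ≠ |b|) (hx : 0 < a * b * x)
    (ha : x ^ 2 < 4 * a ^ 2) (hb : x ^ 2 < 4 * b ^ 2)
    (hT : T ^ 2 = (4 * a ^ 2 - x ^ 2) * (4 * b ^ 2 - x ^ 2)) {k : ℝ}
    (hk : k = 1 / 2 * Real.arccos ((-x ^ 2 + T) / (4 * a * b))) :
    2 * a * b * Real.sin (2 * k) / √(a ^ 2 + b ^ 2 + 2 * a * b * Real.cos (2 * k)) = x := by
  subst hk
  have hab : 4 * a * b ≠ 0 := by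
    intro h
    have : a * b = 0 := by linarith
    simp [this] at hx
  obtain ⟨hl, hu⟩ := quadratic_root_mem_Icc ha hb hT
  rw [dispersion_eq_iff_quadratic hne hx (half_arccos_mem_Icc _), ← mul_assoc,
    mul_one_div_cancel two_ne_zero, one_mul, Real.cos_arccos hl hu, mul_div_cancel₀ _ hab, ← hT]
  ring

lemma eq_half_arccos_of_dispersion {a b x S k : ℝ} (hne : |a| ≠ |b|) (hx : 0 < a * b * x)
    (hS : S ^ 2 = (4 * a ^ 2 - x ^ 2) * (4 * b ^ 2 - x ^ 2)) (hk : k ∈ Set.Icc 0 (π / 2))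
    (h : 2 * a * b * Real.sin (2 * k) / √(a ^ 2 + b ^ 2 + 2 * a * b * Real.cos (2 * k)) = x) :
    k = 1 / 2 * Real.arccos ((-x ^ 2 + S) / (4 * a * b)) ∨
      k = 1 / 2 * Real.arccos ((-x ^ 2 - S) / (4 * a * b)) := by
  have hab : 4 * a * b ≠ 0 := by
    intro h
    have : a * b = 0 := by linarith
    simp [this] at hx
  have hk_eq : k = 1 / 2 * Real.arccos (Real.cos (2 * k)) := by
    rw [Real.arccos_cos (by linarith [hk.1]) (by linarith [hk.2])]
    ring
  rw [dispersion_eq_iff_quadratic hne hx hk, ← hS, sq_eq_sq_iff_eq_or_eq_neg] at h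
  refine h.imp (fun h => ?_) fun h => ?_
  all_goals
    refine hk_eq.trans ?_
    congr 2
    rw [eq_div_iff hab]
    linarith

/-- For `γ₀γ₁ > 0` and `0 < x < 2|γ_ξ|` (resp. `γ₀γ₁ < 0` and `-2|γ_ξ| < x < 0`), the points
`k₊(x)` and `k₋(x)` lie in `[0, π/2]`, satisfy `h(k₊(x)) = x = h(k₋(x))` with `k₊(x) ≤ k₋(x)`,
and are the only solutions of `h(k) = x` in `[0, π/2]`. -/
theorem stmt_12 (γ₀ γ₁ : ℝ) (hγ₀ : γ₀ ≠ 0) (hγ₁ : γ₁ ≠ 0) (hne : |γ₀| ≠ |γ₁|)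
    (g : ℝ → ℝ) (hg : ∀ k, g k = γ₀ ^ 2 + γ₁ ^ 2 + 2 * γ₀ * γ₁ * Real.cos (2 * k))
    (h : ℝ → ℝ) (hh : ∀ k, h k = 2 * γ₀ * γ₁ * Real.sin (2 * k) / Real.sqrt (g k))
    (γξ : ℝ) (hξ : γξ = γ₀ ∨ γξ = γ₁) (hmin : |γξ| = min |γ₀| |γ₁|) :
    (γ₀ * γ₁ > 0 → ∀ x : ℝ, 0 < x → x < 2 * |γξ| →
      let kp := (1 / 2) * Real.arccos
        ((-x ^ 2 + Real.sqrt (4 * γ₀ ^ 2 - x ^ 2) * Real.sqrt (4 * γ₁ ^ 2 - x ^ 2)) /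
          (4 * γ₀ * γ₁));
      let km := (1 / 2) * Real.arccos
        ((-x ^ 2 - Real.sqrt (4 * γ₀ ^ 2 - x ^ 2) * Real.sqrt (4 * γ₁ ^ 2 - x ^ 2)) /
          (4 * γ₀ * γ₁));
      kp ∈ Set.Icc 0 (π / 2) ∧ km ∈ Set.Icc 0 (π / 2) ∧
        h kp = x ∧ h km = x ∧ kp ≤ km ∧
        (∀ k ∈ Set.Icc 0 (π / 2), h k = x → k = kp ∨ k = km)) ∧
    (γ₀ * γ₁ < 0 → ∀ x : ℝ, -(2 * |γξ|) < x → x < 0 →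
      let kp := (1 / 2) * Real.arccos
        ((-x ^ 2 - Real.sqrt (4 * γ₀ ^ 2 - x ^ 2) * Real.sqrt (4 * γ₁ ^ 2 - x ^ 2)) /
          (4 * γ₀ * γ₁));
      let km := (1 / 2) * Real.arccos
        ((-x ^ 2 + Real.sqrt (4 * γ₀ ^ 2 - x ^ 2) * Real.sqrt (4 * γ₁ ^ 2 - x ^ 2)) /
          (4 * γ₀ * γ₁));
      kp ∈ Set.Icc 0 (π / 2) ∧ km ∈ Set.Icc 0 (π / 2) ∧
        h kp = x ∧ h km = x ∧ kp ≤ km ∧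
        (∀ k ∈ Set.Icc 0 (π / 2), h k = x → k = kp ∨ k = km)) := by
  have hbound : ∀ x : ℝ, |x| < 2 * |γξ| → x ^ 2 < 4 * γ₀ ^ 2 ∧ x ^ 2 < 4 * γ₁ ^ 2 := by
    intro x hx
    have h₀ : |γξ| ≤ |γ₀| := hmin ▸ min_le_left _ _
    have h₁ : |γξ| ≤ |γ₁| := hmin ▸ min_le_right _ _
    rw [← sq_abs x, ← sq_abs γ₀, ← sq_abs γ₁]
    constructor <;> nlinarith [abs_nonneg x]
  have hsq : ∀ x : ℝ, x ^ 2 < 4 * γ₀ ^ 2 → x ^ 2 < 4 * γ₁ ^ 2 →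
      (√(4 * γ₀ ^ 2 - x ^ 2) * √(4 * γ₁ ^ 2 - x ^ 2)) ^ 2 =
        (4 * γ₀ ^ 2 - x ^ 2) * (4 * γ₁ ^ 2 - x ^ 2) := by
    intro x h₀ h₁
    rw [mul_pow, Real.sq_sqrt (by linarith), Real.sq_sqrt (by linarith)]
  simp only [hh, hg]
  constructor
  · intro hpos x hx hxlt
    obtain ⟨h₀, h₁⟩ := hbound x (by rwa [abs_of_pos hx])
    have hS := hsq x h₀ h₁
    have hS0 : 0 ≤ √(4 * γ₀ ^ 2 - x ^ 2) * √(4 * γ₁ ^ 2 - x ^ 2) := by positivity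
    have hpx := mul_pos hpos hx
    refine ⟨half_arccos_mem_Icc _, half_arccos_mem_Icc _,
      dispersion_half_arccos hne hpx h₀ h₁ hS rfl,
      dispersion_half_arccos hne hpx h₀ h₁ ((neg_sq _).trans hS) (by rw [sub_eq_add_neg]), ?_,
      fun k hk h => eq_half_arccos_of_dispersion hne hpx hS hk h⟩
    refine mul_le_mul_of_nonneg_left (Real.arccos_le_arccos ?_) (by norm_num)
    exact div_le_div_of_nonneg_right (by linarith) (by linarith)
  · intro hneg x hxlt hx
    obtain ⟨h₀, h₁⟩ := hbound x (by rw [abs_of_neg hx]; linarith)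
    have hS := hsq x h₀ h₁
    have hS0 : 0 ≤ √(4 * γ₀ ^ 2 - x ^ 2) * √(4 * γ₁ ^ 2 - x ^ 2) := by positivity
    have hpx := mul_pos_of_neg_of_neg hneg hx
    refine ⟨half_arccos_mem_Icc _, half_arccos_mem_Icc _,
      dispersion_half_arccos hne hpx h₀ h₁ ((neg_sq _).trans hS) (by rw [sub_eq_add_neg]),
      dispersion_half_arccos hne hpx h₀ h₁ hS rfl, ?_,
      fun k hk h => (eq_half_arccos_of_dispersion hne hpx hS hk h).symm⟩
    refine mul_le_mul_of_nonneg_left (Real.arccos_le_arccos ?_) (by norm_num)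
    exact div_le_div_of_nonpos_of_le (by linarith) (by linarith)
end

section
/- Let ξ ∈ {0,1} satisfy |γ_ξ| = min{|γ₀|, |γ₁|}. For every real x with 0 < |x| < 2|γ_ξ|, the function x ↦ (1/2)·arccos((−x² ± √(4γ₀² − x²)·√(4γ₁² − x²))/(4γ₀γ₁)) is differentiable at x and its derivative equals f_±(x) := ±(1/2)·(x/|x|)·(|γ₀γ₁|/(γ₀γ₁))·|√(4γ₀² − x²) ± √(4γ₁² − x²)|/(√(4γ₀² − x²)·√(4γ₁² − x²)), where the same sign (+ or −) is taken throughout. -/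
open Real

/-- The derivative of `y ↦ (1/2)·arccos((-y² + s√(4γ₀² - y²)√(4γ₁² - y²))/(4γ₀γ₁))` for a sign `s`,
at points where both radicands are positive. -/
theorem hasDerivAt_half_arccos_sqrt_mul_sqrt {γ₀ γ₁ s x : ℝ} (hγ₀ : γ₀ ≠ 0) (hγ₁ : γ₁ ≠ 0)
    (hs : s ^ 2 = 1) (hne : γ₀ ^ 2 ≠ γ₁ ^ 2) (hx : x ≠ 0)
    (h₀ : 0 < 4 * γ₀ ^ 2 - x ^ 2) (h₁ : 0 < 4 * γ₁ ^ 2 - x ^ 2) :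
    HasDerivAt (fun y : ℝ => (1 / 2) * Real.arccos
        ((-y ^ 2 + s * (√(4 * γ₀ ^ 2 - y ^ 2) * √(4 * γ₁ ^ 2 - y ^ 2))) / (4 * γ₀ * γ₁)))
      (s * ((1 / 2) * (x / |x|) * (|γ₀ * γ₁| / (γ₀ * γ₁)) *
        |√(4 * γ₀ ^ 2 - x ^ 2) + s * √(4 * γ₁ ^ 2 - x ^ 2)| /
        (√(4 * γ₀ ^ 2 - x ^ 2) * √(4 * γ₁ ^ 2 - x ^ 2)))) x := by
  have hsqrt (c : ℝ) (hc : 0 < 4 * c ^ 2 - x ^ 2) :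
      HasDerivAt (fun y : ℝ => √(4 * c ^ 2 - y ^ 2)) (-x / √(4 * c ^ 2 - x ^ 2)) x := by
    refine (((hasDerivAt_pow 2 x).const_sub (4 * c ^ 2)).sqrt hc.ne').congr_deriv ?_
    have := (Real.sqrt_pos.2 hc).ne'
    field_simp
    ring
  have hnum : HasDerivAt (fun y : ℝ =>
      (-y ^ 2 + s * (√(4 * γ₀ ^ 2 - y ^ 2) * √(4 * γ₁ ^ 2 - y ^ 2))) / (4 * γ₀ * γ₁)) _ x :=
    ((hasDerivAt_pow 2 x).neg.add
      (((hsqrt γ₀ h₀).mul (hsqrt γ₁ h₁)).const_mul s)).div_const (4 * γ₀ * γ₁)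
  have ha := Real.sqrt_pos.2 h₀
  have hb := Real.sqrt_pos.2 h₁
  have ha2 := Real.sq_sqrt h₀.le
  have hb2 := Real.sq_sqrt h₁.le
  set a := √(4 * γ₀ ^ 2 - x ^ 2)
  set b := √(4 * γ₁ ^ 2 - x ^ 2)
  have hab : a + s * b ≠ 0 := by
    intro h
    have : a ^ 2 = s ^ 2 * b ^ 2 := by linear_combination (a - s * b) * h
    exact hne (by rw [hs] at this; linarith)
  have hγ : γ₀ * γ₁ ≠ 0 := mul_ne_zero hγ₀ hγ₁
  have key : 1 - ((-x ^ 2 + s * (a * b)) / (4 * γ₀ * γ₁)) ^ 2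
      = (x * (a + s * b) / (4 * (γ₀ * γ₁))) ^ 2 := by
    field_simp
    linear_combination (-(4 * γ₁ ^ 2)) * ha2 - (a ^ 2 + x ^ 2) * hb2
      - (a ^ 2 * b ^ 2 + x ^ 2 * b ^ 2) * hs
  have hpos : 0 < (x * (a + s * b) / (4 * (γ₀ * γ₁))) ^ 2 := by positivity
  have hsq : ((-x ^ 2 + s * (a * b)) / (4 * γ₀ * γ₁)) ^ 2 < 1 := by linarith
  have hlt := abs_lt.1 ((sq_lt_one_iff_abs_lt_one _).1 hsq)
  refine (((Real.hasDerivAt_arccos hlt.1.ne' hlt.2.ne).comp x hnum).const_mul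
    (1 / 2)).congr_deriv ?_
  rw [key, Real.sqrt_sq_eq_abs, abs_div, abs_mul, abs_mul 4, abs_of_pos (four_pos : (0 : ℝ) < 4)]
  have hnum_deriv : -(((2 : ℕ) : ℝ) * x ^ (2 - 1)) + s * (-x / a * b + a * (-x / b))
      = -(s * x * (a + s * b) ^ 2 / (a * b)) := by
    field_simp
    push_cast
    linear_combination x * (2 * a * b + s * b ^ 2) * hs
  rw [hnum_deriv, ← sq_abs (a + s * b)]
  have hx' := abs_ne_zero.2 hx
  have hab' := abs_ne_zero.2 hab
  field_simp

/-- For `0 < |x| < 2|γ_ξ|`, the functions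
`x ↦ (1/2)·arccos((-x² ± √(4γ₀² - x²)√(4γ₁² - x²))/(4γ₀γ₁))` are differentiable at `x`
with derivatives `f_±(x)`. -/
theorem stmt_13 (γ₀ γ₁ : ℝ) (hγ₀ : γ₀ ≠ 0) (hγ₁ : γ₁ ≠ 0) (hne : |γ₀| ≠ |γ₁|)
    (γξ : ℝ) (hξ : γξ = γ₀ ∨ γξ = γ₁) (hmin : |γξ| = min |γ₀| |γ₁|) :
    ∀ x : ℝ, 0 < |x| → |x| < 2 * |γξ| →
      HasDerivAt (fun y : ℝ => (1 / 2) * Real.arccos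
          ((-y ^ 2 + Real.sqrt (4 * γ₀ ^ 2 - y ^ 2) * Real.sqrt (4 * γ₁ ^ 2 - y ^ 2)) /
            (4 * γ₀ * γ₁)))
        ((1 / 2) * (x / |x|) * (|γ₀ * γ₁| / (γ₀ * γ₁)) *
          |Real.sqrt (4 * γ₀ ^ 2 - x ^ 2) + Real.sqrt (4 * γ₁ ^ 2 - x ^ 2)| /
          (Real.sqrt (4 * γ₀ ^ 2 - x ^ 2) * Real.sqrt (4 * γ₁ ^ 2 - x ^ 2))) x ∧
      HasDerivAt (fun y : ℝ => (1 / 2) * Real.arccos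
          ((-y ^ 2 - Real.sqrt (4 * γ₀ ^ 2 - y ^ 2) * Real.sqrt (4 * γ₁ ^ 2 - y ^ 2)) /
            (4 * γ₀ * γ₁)))
        (-((1 / 2) * (x / |x|) * (|γ₀ * γ₁| / (γ₀ * γ₁)) *
          |Real.sqrt (4 * γ₀ ^ 2 - x ^ 2) - Real.sqrt (4 * γ₁ ^ 2 - x ^ 2)| /
          (Real.sqrt (4 * γ₀ ^ 2 - x ^ 2) * Real.sqrt (4 * γ₁ ^ 2 - x ^ 2)))) x := by
  intro x hx hxξ
  have hx0 := abs_pos.1 hx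
  have hpos (c : ℝ) (hc : |γξ| ≤ |c|) : 0 < 4 * c ^ 2 - x ^ 2 := by
    have : x ^ 2 < (2 * c) ^ 2 := sq_lt_sq.2 (by rw [abs_mul, abs_two]; linarith)
    linarith
  have h₀ := hpos γ₀ (hmin.trans_le (min_le_left _ _))
  have h₁ := hpos γ₁ (hmin.trans_le (min_le_right _ _))
  have hsq : γ₀ ^ 2 ≠ γ₁ ^ 2 := fun h => hne ((sq_eq_sq_iff_abs_eq_abs _ _).1 h)
  constructor
  · simpa only [one_mul] using
      hasDerivAt_half_arccos_sqrt_mul_sqrt hγ₀ hγ₁ (one_pow 2) hsq hx0 h₀ h₁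
  · simpa only [neg_one_mul, ← sub_eq_add_neg] using
      hasDerivAt_half_arccos_sqrt_mul_sqrt hγ₀ hγ₁ neg_one_sq hsq hx0 h₀ h₁
end

section
/- Let ξ ∈ {0,1} satisfy |γ_ξ| = min{|γ₀|, |γ₁|}. For every natural number r, ∫₀^{π/2} h(k)^r dk + ∫₀^{π/2} (−h(k))^r dk = ∫_{−2|γ_ξ|}^{2|γ_ξ|} x^r/√(4γ_ξ² − x²) dx. -/
open Real MeasureTheory intervalIntegral

/-- Reflecting about `π / 2` and about `0` folds integrals of functions of the sine. -/
lemma integral_comp_sin_add_integral_comp_neg_sin {F : ℝ → ℝ} (hF : Continuous F) :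
    (∫ t in (0:ℝ)..π, F (sin t)) + (∫ t in (0:ℝ)..π, F (-sin t)) =
      2 * ∫ t in (-(π / 2))..(π / 2), F (sin t) := by
  have half (G : ℝ → ℝ) (hG : Continuous G) :
      ∫ t in (0:ℝ)..π, G (sin t) = 2 * ∫ t in (0:ℝ)..(π / 2), G (sin t) := by
    have hc : Continuous fun t => G (sin t) := by fun_prop
    have hr := integral_comp_sub_left (a := 0) (b := π / 2) (fun t => G (sin t)) π
    simp only [sin_pi_sub, sub_zero, sub_half] at hr
    rw [← integral_add_adjacent_intervals (hc.intervalIntegrable 0 (π / 2))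
      (hc.intervalIntegrable (π / 2) π), ← hr]
    ring
  have hc : Continuous fun t => F (sin t) := by fun_prop
  have hn := integral_comp_neg (a := 0) (b := π / 2) (fun t => F (sin t))
  simp only [sin_neg, neg_zero] at hn
  rw [half F hF, half (fun x => F (-x)) (by fun_prop),
    ← integral_add_adjacent_intervals (hc.intervalIntegrable (-(π / 2)) 0)
      (hc.intervalIntegrable 0 (π / 2)), hn]
  ring

/-- The substitution `x = a sin t` in an integral against the arcsine weight. -/
lemma integral_div_sqrt_sq_sub_sq {a : ℝ} (ha : 0 < a) (F : ℝ → ℝ) :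
    ∫ x in (-a)..a, F x / √(a ^ 2 - x ^ 2) = ∫ t in (-(π / 2))..(π / 2), F (a * sin t) := by
  have himage : (fun t => a * sin t) '' Set.Icc (-(π / 2)) (π / 2) = Set.Icc (-a) a := by
    have := Set.image_comp (fun x => a * x) sin (Set.Icc (-(π / 2)) (π / 2))
    rw [bijOn_sin.image_eq, Set.image_mul_left_Icc' ha] at this
    simpa [Function.comp_def] using this
  have hinj : Set.InjOn (fun t => a * sin t) (Set.Icc (-(π / 2)) (π / 2)) :=
    fun x hx y hy hxy => injOn_sin hx hy (mul_left_cancel₀ ha.ne' hxy)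
  rw [integral_of_le (by linarith), integral_of_le (by linarith [pi_pos]),
    ← integral_Icc_eq_integral_Ioc, ← himage,
    integral_image_eq_integral_abs_deriv_smul measurableSet_Icc
      (fun t _ => ((hasDerivAt_sin t).const_mul a).hasDerivWithinAt) hinj,
    integral_Icc_eq_integral_Ioo, integral_Ioc_eq_integral_Ioo]
  refine setIntegral_congr_fun measurableSet_Ioo fun t ht => ?_
  have hpos : 0 < a * cos t := mul_pos ha (cos_pos_of_mem_Ioo ht)
  have hsq : a ^ 2 - (a * sin t) ^ 2 = (a * cos t) ^ 2 := by
    linear_combination -a ^ 2 * sin_sq_add_cos_sq t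
  simp only [hsq, sqrt_sq hpos.le, abs_of_pos hpos, smul_eq_mul]
  have hne : a * cos t ≠ 0 := hpos.ne'
  exact mul_div_cancel₀ _ hne

/-- A function of the sine integrates to zero over `[0, π]` against the cosine. -/
lemma integral_comp_sin_mul_cos_eq_zero (G : ℝ → ℝ) :
    ∫ t in (0:ℝ)..π, G (sin t) * cos t = 0 := by
  have h := integral_comp_sub_left (a := 0) (b := π) (fun t => G (sin t) * cos t) π
  simp only [sin_pi_sub, cos_pi_sub, mul_neg, sub_self, sub_zero,
    intervalIntegral.integral_neg] at h
  linarith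

lemma sq_mul_sin_lt_one {c : ℝ} (hc : |c| < 1) (t : ℝ) : (c * sin t) ^ 2 < 1 := by
  have := (sq_lt_one_iff_abs_lt_one c).2 hc
  nlinarith [sin_sq_le_one t, sq_nonneg (sin t), sq_nonneg c]

lemma sqrt_one_sub_sq_add_mul_cos_pos {c : ℝ} (hc : |c| < 1) (t : ℝ) :
    0 < √(1 - (c * sin t) ^ 2) + c * cos t := by
  have h : |c * cos t| < √(1 - (c * sin t) ^ 2) := by
    refine lt_sqrt_of_sq_lt ?_
    have := (sq_lt_one_iff_abs_lt_one c).2 hc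
    rw [sq_abs]
    nlinarith [sin_sq_add_cos_sq t]
  linarith [neg_abs_le (c * cos t)]

/-- In a triangle with two sides of lengths in ratio `c`, parametrize the angle between them by
an angle at the third side. -/
lemma one_add_sq_add_mul_cos_eq_sq {c : ℝ} (hc : |c| < 1) (t : ℝ) :
    1 + c ^ 2 + 2 * c * cos (t + arcsin (c * sin t)) =
      (√(1 - (c * sin t) ^ 2) + c * cos t) ^ 2 := by
  have hlt := sq_mul_sin_lt_one hc t
  have hb := abs_lt.1 ((sq_lt_one_iff_abs_lt_one _).1 hlt)
  have hs := sq_sqrt (sub_nonneg.2 hlt.le)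
  rw [cos_add, cos_arcsin, sin_arcsin hb.1.le hb.2.le]
  linear_combination -hs - c ^ 2 * sin_sq_add_cos_sq t

lemma sin_add_arcsin_mul_sin {c : ℝ} (hc : |c| < 1) (t : ℝ) :
    sin (t + arcsin (c * sin t)) = sin t * (√(1 - (c * sin t) ^ 2) + c * cos t) := by
  have hb := abs_lt.1 ((sq_lt_one_iff_abs_lt_one _).1 (sq_mul_sin_lt_one hc t))
  rw [sin_add, cos_arcsin, sin_arcsin hb.1.le hb.2.le]
  ring

lemma integral_comp_sin_div_sqrt {c : ℝ} (hc : |c| < 1) {F : ℝ → ℝ} (hF : Continuous F) :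
    ∫ k in (0:ℝ)..(π / 2), F (sin (2 * k) / √(1 + c ^ 2 + 2 * c * cos (2 * k))) =
      (∫ t in (0:ℝ)..π, F (sin t)) / 2 := by
  have hpos (k : ℝ) : 0 < 1 + c ^ 2 + 2 * c * cos (2 * k) := by
    have hc' := (sq_lt_one_iff_abs_lt_one c).2 hc
    nlinarith [sq_nonneg (c + cos (2 * k)), sin_sq_add_cos_sq (2 * k),
      sq_nonneg (c * cos (2 * k) + 1), sq_nonneg (c * sin (2 * k)), sq_nonneg (sin (2 * k))]
  have hderiv (t : ℝ) : HasDerivAt (fun t => (t + arcsin (c * sin t)) / 2)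
      ((1 + 1 / √(1 - (c * sin t) ^ 2) * (c * cos t)) / 2) t := by
    have hb := abs_lt.1 ((sq_lt_one_iff_abs_lt_one _).1 (sq_mul_sin_lt_one hc t))
    exact ((hasDerivAt_id t).add ((hasDerivAt_arcsin hb.1.ne' hb.2.ne).comp t
      ((hasDerivAt_sin t).const_mul c))).div_const 2
  have hne (t : ℝ) : √(1 - (c * sin t) ^ 2) ≠ 0 :=
    (sqrt_pos.2 (sub_pos.2 (sq_mul_sin_lt_one hc t))).ne'
  have hcont : Continuous fun k => F (sin (2 * k) / √(1 + c ^ 2 + 2 * c * cos (2 * k))) :=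
    hF.comp (Continuous.div (by fun_prop) (by fun_prop) fun k => (sqrt_pos.2 (hpos k)).ne')
  have hw : Continuous fun t => 1 / √(1 - (c * sin t) ^ 2) :=
    Continuous.div (by fun_prop) (by fun_prop) hne
  have hsubst := integral_comp_mul_deriv (a := 0) (b := π) (fun t _ => hderiv t)
    (by fun_prop) hcont
  have heq (t : ℝ) : sin (2 * ((t + arcsin (c * sin t)) / 2)) /
      √(1 + c ^ 2 + 2 * c * cos (2 * ((t + arcsin (c * sin t)) / 2))) = sin t := by
    have hp := sqrt_one_sub_sq_add_mul_cos_pos hc t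
    rw [mul_div_cancel₀ _ two_ne_zero, one_add_sq_add_mul_cos_eq_sq hc,
      sin_add_arcsin_mul_sin hc, sqrt_sq hp.le, mul_div_cancel_right₀ _ hp.ne']
  simp only [Function.comp_def, heq, sin_zero, sin_pi, mul_zero, arcsin_zero, add_zero,
    zero_div] at hsubst
  have hzero := integral_comp_sin_mul_cos_eq_zero
    fun s => F s * (1 / √(1 - (c * s) ^ 2)) * c / 2
  calc _ = ∫ t in (0:ℝ)..π, (F (sin t) / 2 +
        F (sin t) * (1 / √(1 - (c * sin t) ^ 2)) * c / 2 * cos t) := by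
        rw [← hsubst]; congr 1; ext t; ring
    _ = _ := by
        rw [intervalIntegral.integral_add
          (Continuous.intervalIntegrable (by fun_prop) _ _)
          (Continuous.intervalIntegrable (by fun_prop) _ _), hzero, add_zero,
          intervalIntegral.integral_div]

/-- The sum of moments depends only on the parameter of smaller absolute value. -/
lemma integral_pow_add_integral_neg_pow {p q : ℝ} (hp : p ≠ 0) (hpq : |p| < |q|) (r : ℕ) :
    (∫ k in (0:ℝ)..(π / 2),
        (2 * p * q * sin (2 * k) / √(p ^ 2 + q ^ 2 + 2 * p * q * cos (2 * k))) ^ r) +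
      (∫ k in (0:ℝ)..(π / 2),
        (-(2 * p * q * sin (2 * k) / √(p ^ 2 + q ^ 2 + 2 * p * q * cos (2 * k)))) ^ r) =
      ∫ x in (-(2 * |p|))..(2 * |p|), x ^ r / √(4 * p ^ 2 - x ^ 2) := by
  have hq0 : 0 < |q| := (abs_nonneg p).trans_lt hpq
  have hq : q ≠ 0 := abs_pos.1 hq0
  have hc : |p / q| < 1 := by rwa [abs_div, div_lt_one hq0]
  have hform (k : ℝ) : 2 * p * q * sin (2 * k) / √(p ^ 2 + q ^ 2 + 2 * p * q * cos (2 * k)) =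
      2 * p * q / |q| *
        (sin (2 * k) / √(1 + (p / q) ^ 2 + 2 * (p / q) * cos (2 * k))) := by
    have : p ^ 2 + q ^ 2 + 2 * p * q * cos (2 * k) =
        q ^ 2 * (1 + (p / q) ^ 2 + 2 * (p / q) * cos (2 * k)) := by
      field_simp
      ring
    rw [this, sqrt_mul (sq_nonneg q), sqrt_sq_eq_abs, mul_div_mul_comm]
  have hsqrt (x : ℝ) : 4 * p ^ 2 - x ^ 2 = (2 * |p|) ^ 2 - x ^ 2 := by
    rw [mul_pow, sq_abs]
    ring
  have hsign : 2 * p * q / |q| = 2 * |p| ∨ 2 * p * q / |q| = -(2 * |p|) := by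
    rw [← abs_eq (by positivity), abs_div, abs_mul, abs_mul, abs_abs, abs_two,
      mul_div_cancel_right₀ _ hq0.ne']
  have hfold := integral_comp_sin_add_integral_comp_neg_sin
    (F := fun s => (2 * |p| * s) ^ r) (by fun_prop)
  simp only [hform, hsqrt]
  rw [integral_comp_sin_div_sqrt hc (F := fun s => (2 * p * q / |q| * s) ^ r) (by fun_prop),
    integral_comp_sin_div_sqrt hc (F := fun s => (-(2 * p * q / |q| * s)) ^ r) (by fun_prop),
    integral_div_sqrt_sq_sub_sq (by positivity) (fun x => x ^ r)]
  simp only [mul_neg] at hfold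
  rcases hsign with hs | hs <;> simp only [hs, neg_mul, neg_neg] <;> linarith

/-- For every natural `r`,
`∫₀^{π/2} h(k)^r dk + ∫₀^{π/2} (-h(k))^r dk = ∫_{-2|γ_ξ|}^{2|γ_ξ|} x^r/√(4γ_ξ² - x²) dx`. -/
theorem stmt_15 (γ₀ γ₁ : ℝ) (hγ₀ : γ₀ ≠ 0) (hγ₁ : γ₁ ≠ 0) (hne : |γ₀| ≠ |γ₁|)
    (g : ℝ → ℝ) (hg : ∀ k, g k = γ₀ ^ 2 + γ₁ ^ 2 + 2 * γ₀ * γ₁ * Real.cos (2 * k))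
    (h : ℝ → ℝ) (hh : ∀ k, h k = 2 * γ₀ * γ₁ * Real.sin (2 * k) / Real.sqrt (g k))
    (γξ : ℝ) (hξ : γξ = γ₀ ∨ γξ = γ₁) (hmin : |γξ| = min |γ₀| |γ₁|) :
    ∀ r : ℕ,
      (∫ k in (0:ℝ)..(π / 2), (h k) ^ r) + (∫ k in (0:ℝ)..(π / 2), (-h k) ^ r) =
        ∫ x in (-(2 * |γξ|))..(2 * |γξ|), x ^ r / Real.sqrt (4 * γξ ^ 2 - x ^ 2) := by
  intro r
  simp only [hh, hg]
  rcases hξ with rfl | rfl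
  · exact integral_pow_add_integral_neg_pow hγ₀
      (lt_of_le_of_ne (hmin ▸ min_le_right _ _) hne) r
  · rw [← integral_pow_add_integral_neg_pow hγ₁
      (lt_of_le_of_ne (hmin ▸ min_le_left _ _) hne.symm) r]
    simp only [mul_right_comm 2 γξ γ₀, add_comm (γξ ^ 2)]
end

section
/- For every natural number n and every real z ≥ 0, ∫₀^{π/2} (2/π)·cos((2n+1)k)·sin(z·cos k) dk = (−1)ⁿ·(1/π)·∫₀^{π} cos((2n+1)θ − z·sin θ) dθ; that is, the odd-site amplitude integral of the quantum walk with γ₁ = γ₀ equals (−1)ⁿ times the Bessel function J_{2n+1}(z) expressed by its standard integral representation. -/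
open Real MeasureTheory intervalIntegral

theorem integral_zero_pi_eq_integral_add_reflection {f : ℝ → ℝ} (hf : Continuous f) :
    ∫ θ in (0:ℝ)..π, f θ = ∫ k in (0:ℝ)..(π / 2), (f (π / 2 - k) + f (π / 2 + k)) := by
  have hl : Continuous fun k => f (π / 2 - k) := by fun_prop
  have hr : Continuous fun k => f (π / 2 + k) := by fun_prop
  rw [integral_add (hl.intervalIntegrable _ _) (hr.intervalIntegrable _ _),
    integral_comp_sub_left f, integral_comp_add_left f, sub_self, sub_zero, add_zero, add_halves,
    integral_add_adjacent_intervals (hf.intervalIntegrable _ _) (hf.intervalIntegrable _ _)]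

theorem cos_add_cos_reflection_odd (n : ℕ) (k x : ℝ) :
    Real.cos ((2 * (n : ℝ) + 1) * (π / 2 - k) - x) +
        Real.cos ((2 * (n : ℝ) + 1) * (π / 2 + k) - x) =
      (-1) ^ n * (2 * Real.cos ((2 * (n : ℝ) + 1) * k) * Real.sin x) := by
  have hl : (2 * (n : ℝ) + 1) * (π / 2 - k) - x =
      π / 2 - ((2 * (n : ℝ) + 1) * k + x) + n * π := by ring
  have hr : (2 * (n : ℝ) + 1) * (π / 2 + k) - x =
      π / 2 - (x - (2 * (n : ℝ) + 1) * k) + n * π := by ring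
  rw [hl, hr, Real.cos_add_nat_mul_pi, Real.cos_add_nat_mul_pi, Real.cos_pi_div_two_sub,
    Real.cos_pi_div_two_sub, Real.sin_add, Real.sin_sub]
  ring

/-- For every natural `n` and real `z ≥ 0`,
`∫₀^{π/2} (2/π) cos((2n+1)k) sin(z cos k) dk = (-1)ⁿ (1/π) ∫₀^π cos((2n+1)θ - z sin θ) dθ`,
i.e. the odd-site amplitude integral equals `(-1)ⁿ J_{2n+1}(z)` in its standard
integral representation. -/
theorem stmt_18 :
    ∀ (n : ℕ) (z : ℝ), 0 ≤ z →
      (∫ k in (0:ℝ)..(π / 2),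
          (2 / π) * Real.cos ((2 * (n : ℝ) + 1) * k) * Real.sin (z * Real.cos k)) =
        (-1) ^ n * ((1 / π) *
          ∫ θ in (0:ℝ)..π, Real.cos ((2 * (n : ℝ) + 1) * θ - z * Real.sin θ)) := by
  intro n z _
  rw [integral_zero_pi_eq_integral_add_reflection
    (f := fun θ => Real.cos ((2 * (n : ℝ) + 1) * θ - z * Real.sin θ)) (by fun_prop),
    ← intervalIntegral.integral_const_mul, ← intervalIntegral.integral_const_mul]
  refine integral_congr fun k _ => ?_
  have hsq : ((-1 : ℝ) ^ n) * (-1) ^ n = 1 := by rw [← mul_pow]; norm_num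
  have hsin : Real.sin (π / 2 + k) = Real.cos k := by rw [add_comm, Real.sin_add_pi_div_two]
  simp only [Real.sin_pi_div_two_sub, hsin, cos_add_cos_reflection_odd]
  linear_combination
    (-(2 / π) * Real.cos ((2 * (n : ℝ) + 1) * k) * Real.sin (z * Real.cos k)) * hsq
end
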